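/- For every n ∈ ℕ with n ≥ 2, the probability P(n,1/2) that a random graph on n vertices with edge probability 1/2 has diameter at most 2 satisfies P(n,1/2) ≥ 1 − (4/9)·n²·(3/4)ⁿ. -/

import Mathlib

open scoped Classical

/-- The probability that a random simple graph on `n` labelled vertices, in which each of
the `n.choose 2` possible edges is included independently with probability `p`, is
connected with diameter at most `2`. -/
noncomputable def diam2Prob (n : ℕ) (p : ℝ) : ℝ :=
  ∑ G : SimpleGraph (Fin n),
    if G.Connected ∧ ∀ u v : Fin n, G.dist u v ≤ 2 then
      p ^ Nat.card G.edgeSet * (1 - p) ^ (n.choose 2 - Nat.card G.edgeSet)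
    else 0

namespace SimpleGraph

/-- Simple graphs correspond to sets of non-diagonal unordered pairs. -/
def equivSetNotDiag (V : Type*) : SimpleGraph V ≃ Set {e : Sym2 V // ¬ e.IsDiag} where
  toFun G := {e | e.1 ∈ G.edgeSet}
  invFun s := fromEdgeSet (Subtype.val '' s)
  left_inv G := by
    ext u v
    simp only [fromEdgeSet_adj, Set.mem_image, Set.mem_ofPred_eq, Subtype.exists, exists_and_left,
      exists_prop, exists_eq_right_right, mem_edgeSet, Sym2.mk_isDiag_iff]
    exact ⟨fun h => h.1.1, fun h => ⟨⟨h, h.ne⟩, h.ne⟩⟩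
  right_inv s := by
    ext ⟨e, he⟩
    simp [edgeSet_fromEdgeSet, he]

theorem card_eq_two_pow (V : Type*) [Fintype V] [Fintype (SimpleGraph V)] :
    Fintype.card (SimpleGraph V) = 2 ^ (Fintype.card V).choose 2 := by
  rw [Fintype.card_congr (equivSetNotDiag V), Fintype.card_set, Sym2.card_subtype_not_diag]

theorem natCard_edgeSet_le_choose_two {V : Type*} [Fintype V] (G : SimpleGraph V) :
    Nat.card G.edgeSet ≤ (Fintype.card V).choose 2 := by
  rw [Nat.card_eq_fintype_card, ← edgeFinset_card]
  exact card_edgeFinset_le_card_choose_two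

/-- If distinct vertices are always adjacent or share a neighbour, the graph is connected of
diameter at most `2`. -/
theorem connected_and_dist_le_two {V : Type*} [Nonempty V] {G : SimpleGraph V}
    (h : ∀ u v, u ≠ v → G.Adj u v ∨ ∃ w, G.Adj u w ∧ G.Adj v w) :
    G.Connected ∧ ∀ u v, G.dist u v ≤ 2 := by
  have key (u v : V) : ∃ p : G.Walk u v, p.length ≤ 2 := by
    rcases eq_or_ne u v with rfl | huv
    · exact ⟨.nil, by simp⟩
    · rcases h u v huv with h | ⟨w, hu, hv⟩
      · exact ⟨h.toWalk, by simp⟩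
      · exact ⟨.cons hu (.cons hv.symm .nil), by simp⟩
  refine ⟨⟨fun u v => (key u v).choose.reachable⟩, fun u v => ?_⟩
  obtain ⟨p, hp⟩ := key u v
  exact (dist_le p).trans hp

/-- `u` and `v` are neither adjacent nor have a common neighbour. -/
def Far {V : Type*} (G : SimpleGraph V) (u v : V) : Prop :=
  ¬ G.Adj u v ∧ ∀ w, ¬ (G.Adj u w ∧ G.Adj v w)

theorem Far.symm {V : Type*} {G : SimpleGraph V} {u v : V} (h : G.Far u v) : G.Far v u :=
  ⟨fun a => h.1 a.symm, fun w a => h.2 w a.symm⟩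

/-- A graph in which `u` and `v` are far apart is determined by its restriction to the other
vertices and by which of `u`, `v` (if any) each of these is joined to. -/
theorem card_far_le {V : Type*} [Fintype V] [Fintype (SimpleGraph V)] {u v : V} (huv : u ≠ v) :
    Fintype.card {G : SimpleGraph V // G.Far u v} ≤
      2 ^ (Fintype.card V - 2).choose 2 * 3 ^ (Fintype.card V - 2) := by
  let W := {w : V // w ≠ u ∧ w ≠ v}
  have hW : Fintype.card W = Fintype.card V - 2 := by
    rw [Fintype.card_subtype, ← Finset.card_pair huv, ← Finset.card_compl]
    congr 1
    ext w
    simp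
  let f : {G : SimpleGraph V // G.Far u v} →
      SimpleGraph W × (W → {p : Bool × Bool // p ≠ (true, true)}) :=
    fun G => (G.1.comap Subtype.val,
      fun w => ⟨(decide (G.1.Adj u w), decide (G.1.Adj v w)), by simpa using G.2.2 w⟩)
  have hf : Function.Injective f := by
    rintro ⟨G, hG⟩ ⟨H, hH⟩ h
    obtain ⟨h₁, h₂⟩ := Prod.ext_iff.1 h
    have hu (w : V) (hw : w ≠ u ∧ w ≠ v) : (G.Adj u w ↔ H.Adj u w) ∧ (G.Adj v w ↔ H.Adj v w) := by
      simpa [f] using congrFun h₂ ⟨w, hw⟩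
    have hc (a b : V) (ha : a ≠ u ∧ a ≠ v) (hb : b ≠ u ∧ b ≠ v) : G.Adj a b ↔ H.Adj a b := by
      have := congrArg (fun K : SimpleGraph W => K.Adj ⟨a, ha⟩ ⟨b, hb⟩) h₁
      simpa [f] using this
    refine Subtype.ext (SimpleGraph.ext ?_)
    ext a b
    have hu' (w : V) : G.Adj u w ↔ H.Adj u w := by
      rcases eq_or_ne w u with rfl | hwu
      · simp
      rcases eq_or_ne w v with rfl | hwv
      · simp [hG.1, hH.1]
      · exact (hu w ⟨hwu, hwv⟩).1
    have hv' (w : V) : G.Adj v w ↔ H.Adj v w := by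
      rcases eq_or_ne w v with rfl | hwv
      · simp
      rcases eq_or_ne w u with rfl | hwu
      · simp [hG.symm.1, hH.symm.1]
      · exact (hu w ⟨hwu, hwv⟩).2
    by_cases ha : a ≠ u ∧ a ≠ v
    · by_cases hb : b ≠ u ∧ b ≠ v
      · exact hc a b ha hb
      · rw [G.adj_comm, H.adj_comm]
        grind
    · grind
  have hc := Fintype.card_le_of_injective f hf
  have h3 : Fintype.card {p : Bool × Bool // p ≠ (true, true)} = 3 := by
    rw [Fintype.card_subtype_compl, Fintype.card_subtype_eq]
    simp
  rwa [Fintype.card_prod, Fintype.card_fun, card_eq_two_pow, h3, hW] at hc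

theorem card_exists_far_le (n : ℕ) [Fintype (SimpleGraph (Fin n))] :
    Fintype.card {G : SimpleGraph (Fin n) // ∃ u v, u ≠ v ∧ G.Far u v} ≤
      n.choose 2 * (2 ^ (n - 2).choose 2 * 3 ^ (n - 2)) := by
  let S (v u : Fin n) : Finset (SimpleGraph (Fin n)) := {G | G.Far u v}
  have hS : ∀ v, ∀ u ∈ Finset.Iio v, (S v u).card ≤ 2 ^ (n - 2).choose 2 * 3 ^ (n - 2) := by
    intro v u hu
    have := card_far_le (Finset.mem_Iio.1 hu).ne
    rwa [Fintype.card_subtype, Fintype.card_fin] at this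
  rw [Fintype.card_subtype]
  calc _ ≤ (Finset.univ.biUnion fun v => (Finset.Iio v).biUnion (S v)).card := by
        refine Finset.card_le_card fun G hG => ?_
        simp only [Finset.mem_filter, Finset.mem_univ, true_and] at hG
        simp only [S, Finset.mem_biUnion, Finset.mem_univ, true_and, Finset.mem_Iio,
          Finset.mem_filter]
        obtain ⟨u, v, huv, h⟩ := hG
        rcases huv.lt_or_gt with hlt | hlt
        · exact ⟨v, u, hlt, h⟩
        · exact ⟨u, v, hlt, h.symm⟩
    _ ≤ ∑ v : Fin n, v.val * (2 ^ (n - 2).choose 2 * 3 ^ (n - 2)) := by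
        refine Finset.card_biUnion_le.trans (Finset.sum_le_sum fun v _ => ?_)
        simpa using Finset.card_biUnion_le_card_mul _ _ _ (hS v)
    _ = _ := by
        rw [← Finset.sum_mul, Fin.sum_univ_eq_sum_range (fun i => i), Finset.sum_range_id,
          Nat.choose_two_right n]

end SimpleGraph

/-- At edge probability `1/2` all graphs are equally likely. -/
theorem diam2Prob_half_eq (n : ℕ) :
    diam2Prob n (1 / 2) =
      (Fintype.card {G : SimpleGraph (Fin n) // G.Connected ∧ ∀ u v, G.dist u v ≤ 2} : ℝ) /
        2 ^ n.choose 2 := by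
  rw [diam2Prob, Fintype.card_subtype, ← Finset.sum_filter]
  rw [Finset.sum_congr rfl (g := fun _ => ((2 : ℝ) ^ n.choose 2)⁻¹), Finset.sum_const,
    nsmul_eq_mul, div_eq_mul_inv]
  intro G _
  have h := G.natCard_edgeSet_le_choose_two
  rw [Fintype.card_fin] at h
  rw [show (1 - 1 / 2 : ℝ) = 1 / 2 by norm_num, ← pow_add, Nat.add_sub_cancel' h, one_div, inv_pow]

/-- For edge probability `1/2`: `P(n,1/2) ≥ 1 - (4/9) n² (3/4)ⁿ`. -/
theorem diam2Prob_half (n : ℕ) (hn : 2 ≤ n) :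
    1 - (4 / 9 : ℝ) * (n : ℝ) ^ 2 * (3 / 4 : ℝ) ^ n ≤ diam2Prob n (1 / 2) := by
  have : Nonempty (Fin n) := ⟨⟨0, by omega⟩⟩
  have hcount : 2 ^ n.choose 2 ≤
      Fintype.card {G : SimpleGraph (Fin n) // G.Connected ∧ ∀ u v, G.dist u v ≤ 2} +
        n.choose 2 * (2 ^ (n - 2).choose 2 * 3 ^ (n - 2)) := by
    have hle : Fintype.card {G : SimpleGraph (Fin n) //
          ¬ (G.Connected ∧ ∀ u v, G.dist u v ≤ 2)} ≤
        Fintype.card {G : SimpleGraph (Fin n) // ∃ u v, u ≠ v ∧ G.Far u v} := by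
      refine Fintype.card_subtype_mono _ _ fun G hG => ?_
      by_contra hfar
      refine hG (SimpleGraph.connected_and_dist_le_two fun u v huv => ?_)
      by_contra h
      push Not at h
      exact hfar ⟨u, v, huv, h.1, fun w hw => h.2 w hw.1 hw.2⟩
    have htot := SimpleGraph.card_eq_two_pow (Fin n)
    rw [Fintype.card_fin] at htot
    rw [Fintype.card_subtype_compl, htot] at hle
    have := SimpleGraph.card_exists_far_le n
    omega
  obtain ⟨m, rfl⟩ := Nat.exists_eq_add_of_le' hn
  rw [Nat.add_sub_cancel] at hcount
  have hchoose : (m + 2).choose 2 = m.choose 2 + (2 * m + 1) := by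
    simp [Nat.choose_succ_succ]
    ring
  have hR : (2 : ℝ) ^ (m + 2).choose 2 ≤
      Fintype.card {G : SimpleGraph (Fin (m + 2)) // G.Connected ∧ ∀ u v, G.dist u v ≤ 2} +
        ((m + 2).choose 2 : ℝ) * (2 ^ m.choose 2 * 3 ^ m) := by
    exact_mod_cast hcount
  rw [diam2Prob_half_eq, le_div_iff₀ (by positivity), sub_mul, one_mul]
  suffices ((m + 2).choose 2 : ℝ) * (2 ^ m.choose 2 * 3 ^ m) ≤
      4 / 9 * ((m + 2 : ℕ) : ℝ) ^ 2 * (3 / 4) ^ (m + 2) * 2 ^ (m + 2).choose 2 by linarith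
  have hpow : 4 / 9 * ((m + 2 : ℕ) : ℝ) ^ 2 * (3 / 4) ^ (m + 2) * 2 ^ (m + 2).choose 2 =
      ((m + 2 : ℕ) : ℝ) ^ 2 / 2 * (2 ^ m.choose 2 * 3 ^ m) := by
    rw [hchoose, pow_add 2, pow_add 2, pow_mul, div_pow, pow_add 3, pow_add 4]
    norm_num
    field_simp
    ring
  rw [hpow, Nat.cast_choose_two]
  gcongr
  push_cast
  nlinarith [(Nat.cast_nonneg m : (0 : ℝ) ≤ m)]
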